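/- arXiv:1912.07312 — 2 statements merged into one kernel-verified Lean document; each statement's English description precedes it below -/
import Mathlib

section
/- Let G = (Q, Σ, δ, I) be a DES with a single observable event, i.e., Σ_o = {a}, and let T_spec ⊆ Q × Q be a specification. Then G is weakly periodically D-detectable with respect to T_spec if and only if G is strongly periodically D-detectable with respect to T_spec. -/
/-! Common framework for discrete event systems (DES) modeled as NFAs. -/

/-- One step of the transition function extended to sets of states. -/
def dStep {Q E : Type*} (δ : Q → E → Set Q) (X : Set Q) (a : E) : Set Q :=
  ⋃ q ∈ X, δ q a

/-- The transition function extended to sets of states and strings (lists of events). -/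
def dRun {Q E : Type*} (δ : Q → E → Set Q) (X : Set Q) : List E → Set Q
  | [] => X
  | a :: w => dRun δ (dStep δ X a) w

/-- The natural projection erasing the unobservable events (those not in `obs`). -/
noncomputable def proj {E : Type*} (obs : Set E) : List E → List E
  | [] => []
  | a :: w => @ite _ (a ∈ obs) (Classical.propDecidable _)
      (a :: proj obs w) (proj obs w)

/-- `Rset δ obs X t` is the set `R(X, t)` of all states reachable from `X`
under some string whose projection is the observation `t`. -/
def Rset {Q E : Type*} (δ : Q → E → Set Q) (obs : Set E) (X : Set Q) (t : List E) : Set Q :=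
  {q | ∃ w : List E, proj obs w = t ∧ q ∈ dRun δ X w}

/-- `s : ℕ → E` is an infinite trajectory of the system, i.e. `s ∈ L^ω(G)`. -/
def IsTrajectory {Q E : Type*} (δ : Q → E → Set Q) (I : Set Q) (s : ℕ → E) : Prop :=
  ∃ r : ℕ → Q, r 0 ∈ I ∧ ∀ n, r (n + 1) ∈ δ (r n) (s n)

/-- The prefix of length `n` of an infinite trajectory. -/
def prefixOf {E : Type*} (s : ℕ → E) (n : ℕ) : List E := (List.range n).map s

/-- The segment of a trajectory between positions `m` and `m'`,
so that `prefixOf s m' = prefixOf s m ++ segmentOf s m m'` whenever `m ≤ m'`. -/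
def segmentOf {E : Type*} (s : ℕ → E) (m m' : ℕ) : List E :=
  (List.range (m' - m)).map fun i => s (m + i)

/-- Every state has at least one outgoing transition. -/
def DeadlockFree {Q E : Type*} (δ : Q → E → Set Q) : Prop :=
  ∀ q : Q, ∃ a : E, (δ q a).Nonempty

/-- No loop consists solely of unobservable events. -/
def NoUnobservableLoop {Q E : Type*} (δ : Q → E → Set Q) (obs : Set E) : Prop :=
  ∀ (q : Q) (w : List E), w ≠ [] → (∀ a ∈ w, a ∉ obs) → q ∉ dRun δ {q} w

/-- Strong detectability. -/
def StronglyDetectable {Q E : Type*} (δ : Q → E → Set Q) (obs : Set E) (I : Set Q) : Prop :=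
  ∃ n : ℕ, ∀ s : ℕ → E, IsTrajectory δ I s → ∀ m : ℕ,
    (proj obs (prefixOf s m)).length > n →
    (Rset δ obs I (proj obs (prefixOf s m))).ncard = 1

/-- Weak detectability. -/
def WeaklyDetectable {Q E : Type*} (δ : Q → E → Set Q) (obs : Set E) (I : Set Q) : Prop :=
  ∃ n : ℕ, ∃ s : ℕ → E, IsTrajectory δ I s ∧ ∀ m : ℕ,
    (proj obs (prefixOf s m)).length > n →
    (Rset δ obs I (proj obs (prefixOf s m))).ncard = 1

/-- Strong periodic detectability. -/
def StronglyPeriodicallyDetectable {Q E : Type*} (δ : Q → E → Set Q) (obs : Set E)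
    (I : Set Q) : Prop :=
  ∃ n : ℕ, ∀ s : ℕ → E, IsTrajectory δ I s → ∀ m : ℕ, ∃ m' : ℕ, m ≤ m' ∧
    (proj obs (segmentOf s m m')).length < n ∧
    (Rset δ obs I (proj obs (prefixOf s m'))).ncard = 1

/-- Weak periodic detectability. -/
def WeaklyPeriodicallyDetectable {Q E : Type*} (δ : Q → E → Set Q) (obs : Set E)
    (I : Set Q) : Prop :=
  ∃ n : ℕ, ∃ s : ℕ → E, IsTrajectory δ I s ∧ ∀ m : ℕ, ∃ m' : ℕ, m ≤ m' ∧
    (proj obs (segmentOf s m m')).length < n ∧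
    (Rset δ obs I (proj obs (prefixOf s m'))).ncard = 1

/-- Strong D-detectability with respect to a specification `T`. -/
def StronglyDDetectable {Q E : Type*} (δ : Q → E → Set Q) (obs : Set E) (I : Set Q)
    (T : Set (Q × Q)) : Prop :=
  ∃ n : ℕ, ∀ s : ℕ → E, IsTrajectory δ I s → ∀ m : ℕ,
    (proj obs (prefixOf s m)).length > n →
    (Rset δ obs I (proj obs (prefixOf s m)) ×ˢ Rset δ obs I (proj obs (prefixOf s m))) ∩ T = ∅

/-- Weak D-detectability with respect to a specification `T`. -/
def WeaklyDDetectable {Q E : Type*} (δ : Q → E → Set Q) (obs : Set E) (I : Set Q)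
    (T : Set (Q × Q)) : Prop :=
  ∃ n : ℕ, ∃ s : ℕ → E, IsTrajectory δ I s ∧ ∀ m : ℕ,
    (proj obs (prefixOf s m)).length > n →
    (Rset δ obs I (proj obs (prefixOf s m)) ×ˢ Rset δ obs I (proj obs (prefixOf s m))) ∩ T = ∅

/-- Strong periodic D-detectability with respect to a specification `T`. -/
def StronglyPeriodicallyDDetectable {Q E : Type*} (δ : Q → E → Set Q) (obs : Set E)
    (I : Set Q) (T : Set (Q × Q)) : Prop :=
  ∃ n : ℕ, ∀ s : ℕ → E, IsTrajectory δ I s → ∀ m : ℕ, ∃ m' : ℕ, m ≤ m' ∧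
    (proj obs (segmentOf s m m')).length < n ∧
    (Rset δ obs I (proj obs (prefixOf s m')) ×ˢ Rset δ obs I (proj obs (prefixOf s m'))) ∩ T = ∅

/-- Weak periodic D-detectability with respect to a specification `T`. -/
def WeaklyPeriodicallyDDetectable {Q E : Type*} (δ : Q → E → Set Q) (obs : Set E)
    (I : Set Q) (T : Set (Q × Q)) : Prop :=
  ∃ n : ℕ, ∃ s : ℕ → E, IsTrajectory δ I s ∧ ∀ m : ℕ, ∃ m' : ℕ, m ≤ m' ∧
    (proj obs (segmentOf s m m')).length < n ∧
    (Rset δ obs I (proj obs (prefixOf s m')) ×ˢ Rset δ obs I (proj obs (prefixOf s m'))) ∩ T = ∅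

theorem proj_append {E : Type*} (obs : Set E) (u v : List E) :
    proj obs (u ++ v) = proj obs u ++ proj obs v := by
  induction u with
  | nil => rfl
  | cons b u ih =>
    simp only [List.cons_append, proj, ih]
    split <;> simp

/-- Over a single observable event an observation is determined by its length. -/
theorem proj_singleton_eq_replicate {E : Type*} (a : E) (w : List E) :
    proj {a} w = List.replicate (proj {a} w).length a := by
  rw [List.eq_replicate_iff]
  refine ⟨rfl, ?_⟩
  induction w with
  | nil => simp [proj]
  | cons b w ih =>
    simp only [proj]
    split
    · rename_i h
      rintro c (_ | ⟨_, hc⟩)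
      exacts [h, ih c hc]
    · exact ih

theorem prefixOf_succ {E : Type*} (s : ℕ → E) (m : ℕ) :
    prefixOf s (m + 1) = prefixOf s m ++ [s m] := by
  simp [prefixOf, List.range_succ]

theorem segmentOf_add_succ {E : Type*} (s : ℕ → E) (m k : ℕ) :
    segmentOf s m (m + (k + 1)) = segmentOf s m (m + k) ++ [s (m + k)] := by
  simp [segmentOf, List.range_succ]

theorem prefixOf_append_segmentOf {E : Type*} (s : ℕ → E) {m m' : ℕ} (h : m ≤ m') :
    prefixOf s m ++ segmentOf s m m' = prefixOf s m' := by
  obtain ⟨k, rfl⟩ := Nat.exists_eq_add_of_le h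
  simp [prefixOf, segmentOf, List.range_add, Function.comp_def]

theorem length_proj_prefixOf_add {E : Type*} (obs : Set E) (s : ℕ → E) {m m' : ℕ}
    (h : m ≤ m') :
    (proj obs (prefixOf s m)).length + (proj obs (segmentOf s m m')).length =
      (proj obs (prefixOf s m')).length := by
  rw [← prefixOf_append_segmentOf s h, proj_append, List.length_append]

theorem dRun_append {Q E : Type*} (δ : Q → E → Set Q) (X : Set Q) (u v : List E) :
    dRun δ X (u ++ v) = dRun δ (dRun δ X u) v := by
  induction u generalizing X with
  | nil => rfl
  | cons b u ih => exact ih _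

theorem mem_dRun_segmentOf {Q E : Type*} {δ : Q → E → Set Q} {s : ℕ → E} {r : ℕ → Q}
    (hr : ∀ n, r (n + 1) ∈ δ (r n) (s n)) (m k : ℕ) :
    r (m + k) ∈ dRun δ {r m} (segmentOf s m (m + k)) := by
  induction k with
  | zero => simp [segmentOf, dRun]
  | succ k ih =>
    rw [segmentOf_add_succ, dRun_append]
    exact Set.mem_biUnion ih (hr (m + k))

theorem IsTrajectory.exists_ge_mem_obs {Q E : Type*} [Finite Q] {δ : Q → E → Set Q}
    {obs : Set E} (hnl : NoUnobservableLoop δ obs) {I : Set Q} {s : ℕ → E}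
    (hs : IsTrajectory δ I s) (m : ℕ) : ∃ j, m ≤ j ∧ s j ∈ obs := by
  obtain ⟨r, -, hr⟩ := hs
  by_contra! hno
  obtain ⟨i, j, hne, hij⟩ := Finite.exists_ne_map_eq_of_infinite fun i => r (m + i)
  wlog hlt : i < j generalizing i j
  · exact this j i hne.symm hij.symm (by omega)
  obtain ⟨k, rfl⟩ := Nat.exists_eq_add_of_lt hlt
  refine hnl (r (m + i)) (segmentOf s (m + i) (m + i + (k + 1))) ?_ ?_ ?_
  · simp [segmentOf_add_succ]
  · intro b hb
    obtain ⟨l, -, rfl⟩ := List.mem_map.1 hb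
    exact hno _ (by omega)
  · have h := mem_dRun_segmentOf hr (m + i) (k + 1)
    have hidx : m + i + (k + 1) = m + (i + k + 1) := by omega
    rw [hidx] at h ⊢
    rwa [← hij] at h

theorem exists_length_proj_prefixOf_eq_succ {E : Type*} {obs : Set E} {s : ℕ → E}
    {m j : ℕ} (hmj : m ≤ j) (hj : s j ∈ obs) :
    ∃ m', m ≤ m' ∧
      (proj obs (prefixOf s m')).length = (proj obs (prefixOf s m)).length + 1 := by
  induction hmj using Nat.decreasingInduction with
  | self => exact ⟨j + 1, by omega, by simp [prefixOf_succ, proj_append, proj, hj]⟩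
  | of_succ k _ ih =>
    by_cases hk : s k ∈ obs
    · exact ⟨k + 1, by omega, by simp [prefixOf_succ, proj_append, proj, hk]⟩
    · obtain ⟨m', hm', h⟩ := ih
      exact ⟨m', by omega, by simpa [prefixOf_succ, proj_append, proj, hk] using h⟩

/-- A trajectory realises every observation length from its current one onwards. -/
theorem IsTrajectory.exists_length_proj_prefixOf_eq {Q E : Type*} [Finite Q]
    {δ : Q → E → Set Q} {obs : Set E} (hnl : NoUnobservableLoop δ obs) {I : Set Q}
    {s : ℕ → E} (hs : IsTrajectory δ I s) (m : ℕ) {k : ℕ}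
    (hk : (proj obs (prefixOf s m)).length ≤ k) :
    ∃ m', m ≤ m' ∧ (proj obs (prefixOf s m')).length = k := by
  induction k, hk using Nat.le_induction with
  | base => exact ⟨m, le_rfl, rfl⟩
  | succ k _ ih =>
    obtain ⟨m', hm', rfl⟩ := ih
    obtain ⟨j, hj, hsj⟩ := hs.exists_ge_mem_obs hnl m'
    obtain ⟨m'', hm'', h⟩ := exists_length_proj_prefixOf_eq_succ hj hsj
    exact ⟨m'', hm'.trans hm'', h⟩

theorem DeadlockFree.exists_isTrajectory {Q E : Type*} {δ : Q → E → Set Q}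
    (hdf : DeadlockFree δ) {I : Set Q} (hI : I.Nonempty) : ∃ s, IsTrajectory δ I s := by
  choose e f hf using hdf
  obtain ⟨q, hq⟩ := hI
  refine ⟨fun n => e (f^[n] q), fun n => f^[n] q, hq, fun n => ?_⟩
  simp only [Function.iterate_succ_apply']
  exact hf _

/-- for a DES `G = (Q, Σ, δ, I)` with a single observable event `Σ_o = {a}`
and a specification `T_spec ⊆ Q × Q`, `G` is weakly periodically D-detectable w.r.t.
`T_spec` if and only if `G` is strongly periodically D-detectable w.r.t. `T_spec`. -/
theorem statement13 {Q E : Type*} [Fintype Q] [Fintype E]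
    (δ : Q → E → Set Q) (a : E) (I : Set Q) (Tspec : Set (Q × Q))
    (hI : I.Nonempty) (hdf : DeadlockFree δ) (hnl : NoUnobservableLoop δ ({a} : Set E)) :
    WeaklyPeriodicallyDDetectable δ ({a} : Set E) I Tspec ↔
      StronglyPeriodicallyDDetectable δ ({a} : Set E) I Tspec := by
  constructor
  · rintro ⟨n, s, hs, h⟩
    refine ⟨n, fun s' hs' m => ?_⟩
    obtain ⟨p, -, hp⟩ := hs.exists_length_proj_prefixOf_eq hnl 0
      (Nat.zero_le (proj {a} (prefixOf s' m)).length)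
    obtain ⟨p', hpp', hlt, hgood⟩ := h p
    have hlen := length_proj_prefixOf_add {a} s hpp'
    obtain ⟨m', hmm', hm'⟩ := hs'.exists_length_proj_prefixOf_eq hnl m
      (k := (proj {a} (prefixOf s p')).length) (by omega)
    have hlen' := length_proj_prefixOf_add {a} s' hmm'
    refine ⟨m', hmm', by omega, ?_⟩
    rwa [proj_singleton_eq_replicate a (prefixOf s' m'), hm',
      ← proj_singleton_eq_replicate a (prefixOf s p')]
  · rintro ⟨n, h⟩
    obtain ⟨s, hs⟩ := hdf.exists_isTrajectory hI
    exact ⟨n, s, hs, h s hs⟩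
end

section
/- Let A = (Q, Σ, δ, I) be an rpoNFA, i.e., its reachability relation (p ≤ q iff there exists w ∈ Σ* with q ∈ δ(p, w)) is a partial order and for every q ∈ Q and a ∈ Σ, q ∈ δ(q, a) implies δ(q, a) = {q}. Then the subset-construction determinization of A is partially ordered: for all subsets X, Y ⊆ Q and strings u, v ∈ Σ*, if δ(X, u) = Y and δ(Y, v) = X, then X = Y. -/
theorem mem_dRun_cons {Q E : Type*} {δ : Q → E → Set Q} {X : Set Q} {a : E} {w : List E} {q : Q} :
    q ∈ dRun δ X (a :: w) ↔ q ∈ dRun δ (dStep δ X a) w := Iff.rfl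

theorem dStep_singleton {Q E : Type*} (δ : Q → E → Set Q) (p : Q) (a : E) :
    dStep δ {p} a = δ p a := by
  simp [dStep]

theorem mem_dRun_iff_exists_singleton {Q E : Type*} {δ : Q → E → Set Q} {X : Set Q} {w : List E}
    {q : Q} : q ∈ dRun δ X w ↔ ∃ p ∈ X, q ∈ dRun δ {p} w := by
  induction w generalizing X with
  | nil => simp [dRun]
  | cons a w ih =>
    simp only [mem_dRun_cons, dStep_singleton]
    rw [ih]
    constructor
    · rintro ⟨r, hr, hq⟩
      simp only [dStep, Set.mem_iUnion, exists_prop] at hr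
      obtain ⟨p, hp, hr⟩ := hr
      exact ⟨p, hp, ih.2 ⟨r, hr, hq⟩⟩
    · rintro ⟨p, hp, hq⟩
      obtain ⟨r, hr, hq⟩ := ih.1 hq
      exact ⟨r, Set.mem_biUnion hp hr, hq⟩

theorem dRun_singleton_trans {Q E : Type*} {δ : Q → E → Set Q} {p q r : Q} {u v : List E}
    (hu : q ∈ dRun δ {p} u) (hv : r ∈ dRun δ {q} v) : r ∈ dRun δ {p} (u ++ v) := by
  rw [dRun_append]
  exact mem_dRun_iff_exists_singleton.2 ⟨q, hu, hv⟩

/-- A run that only reads self-loop letters does not change the set of states. -/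
theorem dRun_eq_self_of_forall_loop {Q E : Type*} {δ : Q → E → Set Q} {X : Set Q} {w : List E}
    (h : ∀ q ∈ X, ∀ a ∈ w, δ q a = {q}) : dRun δ X w = X := by
  induction w with
  | nil => rfl
  | cons a w ih =>
    have hX : dStep δ X a = X :=
      (Set.iUnion₂_congr fun q hq => h q hq a List.mem_cons_self).trans (Set.biUnion_of_singleton X)
    change dRun δ (dStep δ X a) w = X
    rw [hX]
    exact ih fun q hq b hb => h q hq b (List.mem_cons_of_mem _ hb)

/-- If reachability is antisymmetric, a run from a state to itself only uses self-loops. -/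
theorem mem_of_mem_dRun_singleton_self {Q E : Type*} {δ : Q → E → Set Q}
    (hanti : ∀ p q : Q, (∃ w : List E, q ∈ dRun δ ({p} : Set Q) w) →
      (∃ w : List E, p ∈ dRun δ ({q} : Set Q) w) → p = q)
    {q : Q} {w : List E} (h : q ∈ dRun δ {q} w) : ∀ a ∈ w, q ∈ δ q a := by
  induction w with
  | nil => simp
  | cons a w ih =>
    rw [mem_dRun_cons, dStep_singleton] at h
    obtain ⟨r, hr, hq⟩ := mem_dRun_iff_exists_singleton.1 h
    have hqr : q = r := hanti q r ⟨[a], by simpa [dRun, dStep_singleton] using hr⟩ ⟨w, hq⟩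
    subst hqr
    exact List.forall_mem_cons.2 ⟨hr, ih hq⟩

/-- In an rpoNFA, every state of a set fixed by a word has self-loops under its letters. -/
theorem forall_loop_of_dRun_eq_self {Q E : Type*} [Finite Q] {δ : Q → E → Set Q}
    (hanti : ∀ p q : Q, (∃ w : List E, q ∈ dRun δ ({p} : Set Q) w) →
      (∃ w : List E, p ∈ dRun δ ({q} : Set Q) w) → p = q)
    (hsl : ∀ (q : Q) (a : E), q ∈ δ q a → δ q a = ({q} : Set Q))
    {X : Set Q} {w : List E} (hX : dRun δ X w = X) : ∀ q ∈ X, ∀ a ∈ w, δ q a = {q} := by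
  let _ : PartialOrder Q :=
    { le := fun p q => ∃ w : List E, q ∈ dRun δ {p} w
      le_refl := fun _ => ⟨[], rfl⟩
      le_trans := fun _ _ _ ⟨u, hu⟩ ⟨v, hv⟩ => ⟨u ++ v, dRun_singleton_trans hu hv⟩
      le_antisymm := hanti }
  intro q
  induction q using WellFoundedLT.induction with
  | ind q ih =>
    intro hq
    obtain ⟨p, hp, hpq⟩ := mem_dRun_iff_exists_singleton.1 (hX.symm ▸ hq)
    have hqp : q = p := by
      by_contra hne
      have hloop := ih p (lt_of_le_of_ne ⟨w, hpq⟩ (Ne.symm hne)) hp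
      rw [dRun_eq_self_of_forall_loop (by simpa using hloop)] at hpq
      exact hne hpq
    subst hqp
    exact fun a ha => hsl q a (mem_of_mem_dRun_singleton_self hanti hpq a ha)

/-- for an rpoNFA `A = (Q, Σ, δ, I)` (reachability is a partial order and
`q ∈ δ(q, a)` implies `δ(q, a) = {q}`), the subset-construction determinization of `A` is
partially ordered: for all subsets `X, Y ⊆ Q` and strings `u, v`, if `δ(X, u) = Y` and
`δ(Y, v) = X`, then `X = Y`. -/
theorem statement18 {Q E : Type*} [Fintype Q] (δ : Q → E → Set Q) (I : Set Q)
    (hanti : ∀ p q : Q, (∃ w : List E, q ∈ dRun δ ({p} : Set Q) w) →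
      (∃ w : List E, p ∈ dRun δ ({q} : Set Q) w) → p = q)
    (hsl : ∀ (q : Q) (a : E), q ∈ δ q a → δ q a = ({q} : Set Q)) :
    ∀ (X Y : Set Q) (u v : List E), dRun δ X u = Y → dRun δ Y v = X → X = Y := by
  intro X Y u v hu hv
  have hX : dRun δ X (u ++ v) = X := by rw [dRun_append, hu, hv]
  rw [← hu]
  exact (dRun_eq_self_of_forall_loop fun q hq a ha =>
    forall_loop_of_dRun_eq_self hanti hsl hX q hq a (List.mem_append_left v ha)).symm
end
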